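/- Let p, q ≥ 0 be real numbers with p + q < 1, let a, b > 0, and let t₀ ≥ 0 and T > 0. Then the products ω^p cos(aωt) · ∫_{t₀}^{t} ω^q cos(bωτ) dτ converge uniformly to 0 on [t₀, t₀+T] as ω → ∞, i.e. lim_{ω→∞} sup_{t∈[t₀,t₀+T]} | ω^p cos(aωt) · ∫_{t₀}^{t} ω^q cos(bωτ) dτ | = 0; the same holds for each of the variants obtained by replacing either or both occurrences of cos by sin. -/

import Mathlib

open MeasureTheory Filter Topology Set

/-- If `f` is bounded by `1` and the integrals of `g` are bounded by `C`, then the amplified products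
of the oscillations `f (aωt)` and `g (bωτ)` vanish uniformly in `t` when `p + q < 1`. -/
theorem tendstoUniformlyOn_zero_amplified_product {f g : ℝ → ℝ} {C : ℝ}
    (hf : ∀ x, |f x| ≤ 1) (hg : ∀ x y, |∫ u in x..y, g u| ≤ C)
    {p q : ℝ} (hpq : p + q < 1) (a : ℝ) {b : ℝ} (hb : 0 < b) (t₀ : ℝ) (s : Set ℝ) :
    TendstoUniformlyOn
      (fun (ω : ℝ) (t : ℝ) => ω ^ p * f (a * ω * t) * ∫ τ in t₀..t, ω ^ q * g (b * ω * τ))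
      0 atTop s := by
  have hlim : Tendsto (fun ω : ℝ => C / b * ω ^ (-(1 - (p + q)))) atTop (𝓝 0) := by
    simpa using (tendsto_rpow_neg_atTop (sub_pos.2 hpq)).const_mul (C / b)
  rw [Metric.tendstoUniformlyOn_iff]
  intro ε hε
  filter_upwards [hlim.eventually_lt_const hε, eventually_gt_atTop 0] with ω hω hpos t _
  refine lt_of_le_of_lt ?_ hω
  have hc : 0 < b * ω := mul_pos hb hpos
  rw [Pi.zero_apply, dist_zero_left, Real.norm_eq_abs, intervalIntegral.integral_const_mul,
    intervalIntegral.integral_comp_mul_left g hc.ne', smul_eq_mul]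
  have hpow : ω ^ (-(1 - (p + q))) = ω ^ p * ω ^ q * ω⁻¹ := by
    rw [← Real.rpow_neg_one, ← Real.rpow_add hpos, ← Real.rpow_add hpos]
    ring_nf
  simp only [abs_mul, abs_inv, abs_of_pos hb, abs_of_pos hpos, Real.abs_rpow_of_nonneg hpos.le]
  calc ω ^ p * |f (a * ω * t)| * (ω ^ q * ((b * ω)⁻¹ * |∫ u in b * ω * t₀..b * ω * t, g u|))
      ≤ ω ^ p * 1 * (ω ^ q * ((b * ω)⁻¹ * C)) := by
        gcongr
        · exact hf _
        · exact hg _ _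
    _ = C / b * ω ^ (-(1 - (p + q))) := by
        rw [hpow, mul_inv]
        ring

theorem abs_integral_cos_le_two (x y : ℝ) : |∫ u in x..y, Real.cos u| ≤ 2 := by
  rw [integral_cos, abs_le]
  constructor <;>
    linarith [Real.neg_one_le_sin x, Real.sin_le_one x, Real.neg_one_le_sin y, Real.sin_le_one y]

theorem abs_integral_sin_le_two (x y : ℝ) : |∫ u in x..y, Real.sin u| ≤ 2 := by
  rw [integral_sin, abs_le]
  constructor <;>
    linarith [Real.neg_one_le_cos x, Real.cos_le_one x, Real.neg_one_le_cos y, Real.cos_le_one y]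

/-- For `p, q ≥ 0` with `p + q < 1`, the products
`ω^p trig₁(aωt) · ∫_{t₀}^{t} ω^q trig₂(bωτ) dτ` converge uniformly to `0`
on `[t₀, t₀+T]` as `ω → ∞`, for all four cos/sin variants. -/
theorem subcritical_amplified_products_uniform_limit_zero
    (p q : ℝ) (hp : 0 ≤ p) (hq : 0 ≤ q) (hpq : p + q < 1)
    (a b : ℝ) (ha : 0 < a) (hb : 0 < b)
    (t₀ T : ℝ) (ht₀ : 0 ≤ t₀) (hT : 0 < T) :
    TendstoUniformlyOn
      (fun (ω : ℝ) (t : ℝ) =>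
        ω ^ p * Real.cos (a * ω * t) * ∫ τ in t₀..t, ω ^ q * Real.cos (b * ω * τ))
      0 atTop (Icc t₀ (t₀ + T)) ∧
    TendstoUniformlyOn
      (fun (ω : ℝ) (t : ℝ) =>
        ω ^ p * Real.cos (a * ω * t) * ∫ τ in t₀..t, ω ^ q * Real.sin (b * ω * τ))
      0 atTop (Icc t₀ (t₀ + T)) ∧
    TendstoUniformlyOn
      (fun (ω : ℝ) (t : ℝ) =>
        ω ^ p * Real.sin (a * ω * t) * ∫ τ in t₀..t, ω ^ q * Real.cos (b * ω * τ))
      0 atTop (Icc t₀ (t₀ + T)) ∧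
    TendstoUniformlyOn
      (fun (ω : ℝ) (t : ℝ) =>
        ω ^ p * Real.sin (a * ω * t) * ∫ τ in t₀..t, ω ^ q * Real.sin (b * ω * τ))
      0 atTop (Icc t₀ (t₀ + T)) := by
  have hcos := Real.abs_cos_le_one
  have hsin := Real.abs_sin_le_one
  exact ⟨tendstoUniformlyOn_zero_amplified_product hcos abs_integral_cos_le_two hpq a hb t₀ _,
    tendstoUniformlyOn_zero_amplified_product hcos abs_integral_sin_le_two hpq a hb t₀ _,
    tendstoUniformlyOn_zero_amplified_product hsin abs_integral_cos_le_two hpq a hb t₀ _,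
    tendstoUniformlyOn_zero_amplified_product hsin abs_integral_sin_le_two hpq a hb t₀ _⟩
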